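/- Let a = (1 + √10)/6, Tₙ ⊂ ℝⁿ as above, and Sₙ = Tₙ ∪ (−Tₙ). Then vol(Sₙ)/vol(Bₙ) → 2·(1/2)ⁿ asymptotically, i.e., 2ⁿ · vol(Sₙ)/vol(Bₙ) → 2 as n → ∞. -/

import Mathlib

open MeasureTheory Metric Filter

noncomputable def a : ℝ := (1 + Real.sqrt 10) / 6

noncomputable def T (n : ℕ) : Set (EuclideanSpace ℝ (Fin (n + 2))) :=
  {x | x 0 > 1/2 ∧ ‖x - a • EuclideanSpace.single (0 : Fin (n + 2)) (1 : ℝ)‖ < 1/2 ∧ ‖x‖ < 1}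

lemma a_eq : 3 * a ^ 2 - a - 3 / 4 = 0 := by
  have h : Real.sqrt 10 ^ 2 = 10 := Real.sq_sqrt (by norm_num)
  unfold a
  nlinarith

lemma a_gt : 1 / 2 < a := by
  have h : 2 < Real.sqrt 10 := Real.lt_sqrt_of_sq_lt (by norm_num)
  unfold a
  linarith

lemma a_lt : a < 1 := by
  have h : Real.sqrt 10 < 5 := by
    rw [Real.sqrt_lt' (by norm_num)]; norm_num
  unfold a
  linarith

lemma norm_sub_e (n : ℕ) (x : EuclideanSpace ℝ (Fin (n + 2))) (c : ℝ) :
    ‖x - c • EuclideanSpace.single (0 : Fin (n + 2)) (1 : ℝ)‖ ^ 2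
      = ‖x‖ ^ 2 - 2 * c * x 0 + c ^ 2 := by
  rw [norm_sub_sq_real, norm_smul, inner_smul_right, EuclideanSpace.inner_single_right]
  simp
  ring

/-- The radius of the ball covering a cap. -/
noncomputable def rad : ℝ := Real.sqrt (1 / 4 - (a - 1 / 2) ^ 2)

lemma rad_sq : rad ^ 2 = 1 / 4 - (a - 1 / 2) ^ 2 := by
  apply Real.sq_sqrt
  nlinarith [a_gt, a_lt]

lemma rad_nonneg : 0 ≤ rad := Real.sqrt_nonneg _

lemma rad_lt : rad < 1 / 2 := by
  have := rad_sq
  have := rad_nonneg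
  nlinarith [a_gt]

lemma T_sub (n : ℕ) :
    T n ⊆ ball (a • EuclideanSpace.single (0 : Fin (n + 2)) (1 : ℝ)) (1 / 2) := by
  intro x hx
  rw [mem_ball, dist_eq_norm]
  exact hx.2.1

lemma ball_subset_T_union (n : ℕ) :
    ball (a • EuclideanSpace.single (0 : Fin (n + 2)) (1 : ℝ)) (1 / 2) ⊆
      T n ∪ (ball ((2 * a - 1 / 2) • EuclideanSpace.single (0 : Fin (n + 2)) (1 : ℝ)) rad ∪
        ball ((1 / 2 : ℝ) • EuclideanSpace.single (0 : Fin (n + 2)) (1 : ℝ)) rad) := by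
  intro x hx
  by_contra hcon
  simp only [Set.mem_union, not_or] at hcon
  obtain ⟨h1, h2, h3⟩ := hcon
  rw [mem_ball, dist_eq_norm] at hx h2 h3
  apply h1
  have hr := rad_sq
  have hr0 := rad_nonneg
  have hx2 := pow_lt_pow_left₀ hx (norm_nonneg _) (two_ne_zero)
  have h2' := pow_le_pow_left₀ hr0 (not_lt.1 h2) 2
  have h3' := pow_le_pow_left₀ hr0 (not_lt.1 h3) 2
  rw [norm_sub_e] at hx2 h2' h3'
  have ha := a_gt
  have hq := a_eq
  have k1 : 1 / 2 < x 0 := by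
    by_contra hc
    nlinarith
  have k2 : x 0 < 2 * a - 1 / 2 := by
    by_contra hc
    nlinarith
  refine ⟨k1, hx, ?_⟩
  have : ‖x‖ ^ 2 < 1 := by nlinarith
  nlinarith [norm_nonneg x]

lemma T_open (n : ℕ) : IsOpen (T n) := by
  have e : T n = {x | 1 / 2 < x 0} ∩
    ({x | ‖x - a • EuclideanSpace.single (0 : Fin (n + 2)) (1 : ℝ)‖ < 1/2} ∩ {x | ‖x‖ < 1}) := rfl
  rw [e]
  refine IsOpen.inter ?_ (IsOpen.inter ?_ ?_)
  · exact isOpen_lt (by fun_prop) (by fun_prop)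
  · exact isOpen_lt (by fun_prop) (by fun_prop)
  · exact isOpen_lt (by fun_prop) (by fun_prop)

lemma vol_ball (n : ℕ) (c : EuclideanSpace ℝ (Fin (n + 2))) (r : ℝ) (hr : 0 ≤ r) :
    volume.real (ball c r) = r ^ (n + 2) *
      volume.real (ball (0 : EuclideanSpace ℝ (Fin (n + 2))) 1) := by
  rw [measureReal_def, Measure.addHaar_ball _ _ hr, ENNReal.toReal_mul,
    ENNReal.toReal_ofReal (by positivity), finrank_euclideanSpace_fin, measureReal_def]

lemma vol_S (n : ℕ) : volume.real (T n ∪ -T n) = 2 * volume.real (T n) := by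
  have hfin : volume (T n) ≠ ⊤ := ((measure_mono (T_sub n)).trans_lt measure_ball_lt_top).ne
  have hneg : volume (-T n) = volume (T n) := Measure.measure_neg _ _
  rw [measureReal_union _ (T_open n).neg.measurableSet hfin (by rw [hneg]; exact hfin)]
  · simp only [measureReal_def, hneg]; ring
  · rw [Set.disjoint_left]
    intro x hx hx'
    have h1 := hx.1
    have h2 : (-x) 0 > 1 / 2 := hx'.1
    simp at h2
    linarith

theorem stmt_12 :
    Tendsto (fun n : ℕ =>
        2 ^ (n + 2) * (volume (T n ∪ -T n)).toReal /
          (volume (ball (0 : EuclideanSpace ℝ (Fin (n + 2))) 1)).toReal)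
      atTop (nhds 2) := by
  have hlim : Tendsto (fun n : ℕ => 2 * (1 - 2 * (2 * rad) ^ (n + 2))) atTop (nhds 2) := by
    have h0 : Tendsto (fun n : ℕ => (2 * rad) ^ (n + 2)) atTop (nhds 0) :=
      (tendsto_add_atTop_iff_nat 2).2 (tendsto_pow_atTop_nhds_zero_of_lt_one
        (by linarith [rad_nonneg]) (by linarith [rad_lt]))
    have := ((h0.const_mul 2).const_sub 1).const_mul 2
    simpa using this
  refine tendsto_of_tendsto_of_tendsto_of_le_of_le hlim tendsto_const_nhds ?_ ?_
  all_goals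
    intro n
    change _ ≤ _
    simp only [← measureReal_def]
    have hV : 0 < volume.real (ball (0 : EuclideanSpace ℝ (Fin (n + 2))) 1) :=
      ENNReal.toReal_pos (measure_ball_pos _ _ one_pos).ne' measure_ball_lt_top.ne
    have hfin : volume (T n) ≠ ⊤ := ((measure_mono (T_sub n)).trans_lt measure_ball_lt_top).ne
    have hp : (2 : ℝ) ^ (n + 2) * (1 / 2) ^ (n + 2) = 1 := by
      rw [← mul_pow]; norm_num
    have h2 : (0 : ℝ) < 2 ^ (n + 2) := by positivity
    rw [vol_S]
  · rw [le_div_iff₀ hV, mul_pow]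
    have h := measureReal_mono (μ := volume) (ball_subset_T_union n)
      (measure_union_ne_top hfin
        (measure_union_ne_top measure_ball_lt_top.ne measure_ball_lt_top.ne))
    have h' := h.trans ((measureReal_union_le _ _).trans
      (add_le_add le_rfl (measureReal_union_le _ _)))
    rw [vol_ball _ _ _ rad_nonneg, vol_ball _ _ _ rad_nonneg,
      vol_ball _ _ _ (by norm_num)] at h'
    have h3 := mul_le_mul_of_nonneg_left h' h2.le
    rw [← mul_assoc, hp] at h3
    linarith
  · rw [div_le_iff₀ hV]
    have h := measureReal_mono (μ := volume) (T_sub n) measure_ball_lt_top.ne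
    rw [vol_ball _ _ _ (by norm_num)] at h
    have h3 := mul_le_mul_of_nonneg_left h h2.le
    rw [← mul_assoc, hp] at h3
    linarith
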